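/- Let f* : D → C be a coproduct-preserving tensor-exact functor between rigidly-compactly generated tensor-triangulated categories satisfying Grothendieck-Neeman duality, with relative dualizing object ω := f^(1)(𝟙). Then ω is ⊗-invertible (so the Wirthmüller isomorphism holds) as soon as f_* satisfies any one of the following conditions: (1) f_* is faithful; (2) f_* detects compact objects, i.e. any x ∈ C is compact whenever f_*(x) is compact; (3) any x ∈ C is compact whenever f_*(x ⊗ y) is compact for every compact y ∈ C. Moreover (1) implies (2) and (2) implies (3). -/

import Mathlib

/-!
Formalization of statements from "Grothendieck-Neeman duality and the
Wirthmüller isomorphism" by Balmer, Dell'Ambrogio and Sanders.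
-/

noncomputable section

open CategoryTheory CategoryTheory.Limits CategoryTheory.Pretriangulated
  CategoryTheory.MonoidalCategory CategoryTheory.MonoidalClosed Opposite

universe v u u₁ u₂ u₃

namespace GN

section Compact

variable {C : Type u} [Category.{v} C]

/-- An object `t` is compact if `Hom(t, -)`, viewed as a functor to abelian groups,
preserves small coproducts. -/
def IsCompactObj [Preadditive C] (t : C) : Prop :=
  ∀ J : Type v, Nonempty (PreservesColimitsOfShape (Discrete J)
    (preadditiveCoyoneda.obj (op t)))

/-- A functor preserves arbitrary (small) coproducts. -/
def PreservesCoproducts {D : Type u₂} [Category.{v} D] (F : C ⥤ D) : Prop :=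
  ∀ J : Type v, Nonempty (PreservesColimitsOfShape (Discrete J) F)

/-- A functor preserves arbitrary (small) products. -/
def PreservesProducts {D : Type u₂} [Category.{v} D] (F : C ⥤ D) : Prop :=
  ∀ J : Type v, Nonempty (PreservesLimitsOfShape (Discrete J) F)

/-- A compactly generated category: it admits all small coproducts and
has a set of compact generators. -/
structure CompactlyGenerated (C : Type u) [Category.{v} C] [Preadditive C] : Prop where
  hasCoproducts : HasCoproducts.{v} C
  exists_generators : ∃ (ι : Type v) (G : ι → C), (∀ i, IsCompactObj (G i)) ∧
    ∀ t : C, (∀ (i : ι) (f : G i ⟶ t), f = 0) → IsZero t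

end Compact

section Tensor

variable {C : Type u} [Category.{v} C] [MonoidalCategory C] [MonoidalClosed C]

/-- The canonical map `hom(x,𝟙) ⊗ y ⟶ hom(x,y)`. -/
def rigidComparison (x y : C) : (ihom x).obj (𝟙_ C) ⊗ y ⟶ (ihom x).obj y :=
  MonoidalClosed.curry ((α_ x ((ihom x).obj (𝟙_ C)) y).inv ≫
    (((ihom.ev x).app (𝟙_ C)) ▷ y) ≫ (λ_ y).hom)

/-- An object `x` is rigid if `hom(x,𝟙) ⊗ y ⟶ hom(x,y)` is an isomorphism for all `y`. -/
def IsRigid (x : C) : Prop := ∀ y : C, IsIso (rigidComparison x y)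

/-- An object `u` is `⊗`-invertible if `u ⊗ v ≅ 𝟙` for some `v`. -/
def TensorInvertible (u : C) : Prop := ∃ v : C, Nonempty (u ⊗ v ≅ 𝟙_ C)

/-- The `κ`-twisted duality functor `D_κ = hom(-,κ)`. -/
@[reducible] def Dfun (κ : C) : Cᵒᵖ ⥤ C := MonoidalClosed.internalHom.flip.obj κ

/-- The canonical double-duality map `ϖ : x ⟶ D_κ D_κ (x)`, i.e. the unit/counit of the
self-adjunction of `D_κ = hom(-,κ)`. -/
def varpi [BraidedCategory C] (κ x : C) : x ⟶ (ihom ((ihom x).obj κ)).obj κ :=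
  MonoidalClosed.curry ((β_ ((ihom x).obj κ) x).hom ≫ (ihom.ev x).app κ)

/-- A rigidly-compactly generated tensor-triangulated category: it admits all small
coproducts, its compact objects coincide with its rigid objects, and it has a set of
compact generators. -/
structure RigidlyCompactlyGenerated (C : Type u) [Category.{v} C] [Preadditive C]
    [MonoidalCategory C] [MonoidalClosed C] : Prop where
  hasCoproducts : HasCoproducts.{v} C
  compact_iff_rigid : ∀ x : C, IsCompactObj x ↔ IsRigid x
  exists_generators : ∃ (ι : Type v) (G : ι → C), (∀ i, IsCompactObj (G i)) ∧
    ∀ t : C, (∀ (i : ι) (f : G i ⟶ t), f = 0) → IsZero t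

end Tensor

section Triang

variable {C : Type u} [Category.{v} C] [HasZeroObject C] [Preadditive C] [HasShift C ℤ]
  [∀ n : ℤ, (shiftFunctor C n).Additive] [Pretriangulated C]

/-- A thick triangulated subcategory, given as a predicate on objects:
it contains the zero objects, and is closed under shifts, cones and direct summands
(hence in particular under isomorphisms). -/
structure IsThickSubcategory (S : Set C) : Prop where
  zero : ∀ x : C, IsZero x → x ∈ S
  shift : ∀ x ∈ S, ∀ n : ℤ, x⟦n⟧ ∈ S
  ext₃ : ∀ T : Triangle C, (T ∈ distTriang C) → T.obj₁ ∈ S → T.obj₂ ∈ S → T.obj₃ ∈ S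
  retract : ∀ x y : C, (∃ (s : x ⟶ y) (r : y ⟶ x), s ≫ r = 𝟙 x) → y ∈ S → x ∈ S

/-- The thick subcategory generated by a set of objects. -/
def thickClosure (S : Set C) : Set C :=
  { x | ∀ T : Set C, IsThickSubcategory T → S ⊆ T → x ∈ T }

/-- A `C^c`-submodule of `C`: a thick triangulated subcategory which is closed under
tensoring with compact objects. -/
structure IsSubmodule [MonoidalCategory C] (S : Set C) extends IsThickSubcategory S : Prop where
  smul : ∀ c x : C, IsCompactObj c → x ∈ S → (c ⊗ x) ∈ S

end Triang

section Dual

variable {C : Type u} [Category.{v} C] [MonoidalCategory C] [BraidedCategory C]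
  [MonoidalClosed C]

/-- `κ` is a (possibly external) dualizing object for `S ⊆ C`: the `κ`-twisted
duality `D_κ = hom(-,κ)` preserves `S` and every object of `S` is `κ`-reflexive;
equivalently, `D_κ` restricts to an anti-equivalence `S^op ≃ S`. -/
structure IsExternalDualizing (S : Set C) (κ : C) : Prop where
  stable : ∀ x ∈ S, (ihom x).obj κ ∈ S
  reflexive : ∀ x ∈ S, IsIso (varpi κ x)

/-- `κ ∈ S` is a dualizing object for `S`. -/
structure IsDualizing (S : Set C) (κ : C) extends IsExternalDualizing S κ : Prop where
  mem : κ ∈ S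

end Dual

section Pullback

variable {C : Type u₁} {D : Type u₂} [Category.{v} C] [Category.{v} D]
  [Preadditive C] [MonoidalCategory C]

/-- The compact pull-back `f^#(D₀)` of a subcategory `D₀ ⊆ D` along `f_* : C ⥤ D`. -/
def compactPullback (fpush : C ⥤ D) (D₀ : Set D) : Set C :=
  { x | ∀ c : C, IsCompactObj c → fpush.obj (c ⊗ x) ∈ D₀ }

end Pullback

section Proj

variable {D : Type u₁} {C : Type u₂} [Category.{v} D] [Category.{v} C]
  [MonoidalCategory D] [MonoidalCategory C]

/-- The canonical projection formula map `π : x ⊗ f_*(y) ⟶ f_*(f^*(x) ⊗ y)`,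
obtained by adjunction from `f^*(x ⊗ f_* y) ≅ f^* x ⊗ f^* f_* y → f^* x ⊗ y`. -/
def projFormula (fstar : D ⥤ C) [fstar.Monoidal] (fpush : C ⥤ D) (adj : fstar ⊣ fpush)
    (x : D) (y : C) : x ⊗ fpush.obj y ⟶ fpush.obj (fstar.obj x ⊗ y) :=
  (adj.homEquiv _ _)
    (Functor.OplaxMonoidal.δ fstar x (fpush.obj y) ≫ (fstar.obj x ◁ adj.counit.app y))

/-- The canonical comparison map `f^(1)(x) ⊗ f^*(y) ⟶ f^(1)(x ⊗ y)`, obtained by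
adjunction from the counit `f_* f^(1) → Id` via the projection formula. -/
def gnComparison [BraidedCategory D] [BraidedCategory C] (fstar : D ⥤ C) [fstar.Monoidal]
    (fpush : C ⥤ D) (adj1 : fstar ⊣ fpush) (fone : D ⥤ C) (adj2 : fpush ⊣ fone)
    (hπ : ∀ (x : D) (y : C), IsIso (projFormula fstar fpush adj1 x y)) (x y : D) :
    fone.obj x ⊗ fstar.obj y ⟶ fone.obj (x ⊗ y) :=
  haveI := hπ y (fone.obj x)
  (adj2.homEquiv _ _)
    (fpush.map (β_ (fone.obj x) (fstar.obj y)).hom ≫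
      inv (projFormula fstar fpush adj1 y (fone.obj x)) ≫
      (β_ y (fpush.obj (fone.obj x))).hom ≫ (adj2.counit.app x ▷ y))

end Proj

section CompactLemmas

/-- A retract of a functor preserving colimits of shape `J` preserves them too. -/
theorem preservesColimitsOfShape_of_retract {A B : Type*} [Category* A] [Category* B]
    {J : Type*} [Category* J] {F G : A ⥤ B} (h : Retract F G)
    [PreservesColimitsOfShape J G] : PreservesColimitsOfShape J F where
  preservesColimit {K} :=
    { preserves := fun {c} hc => ⟨by
        have hG := isColimitOfPreserves G hc
        have hir (X : A) : h.i.app X ≫ h.r.app X = 𝟙 _ := by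
          rw [← NatTrans.comp_app, h.retract, NatTrans.id_app]
        exact
          { desc := fun s => h.i.app c.pt ≫
              hG.desc ((Cocone.precompose (Functor.whiskerLeft K h.r)).obj s)
            fac := fun s j => by
              have := hG.fac ((Cocone.precompose (Functor.whiskerLeft K h.r)).obj s) j
              dsimp at this ⊢
              rw [h.i.naturality_assoc, this, reassoc_of% (hir (K.obj j))]
            uniq := fun s m hm => by
              have : h.r.app c.pt ≫ m =
                  hG.desc ((Cocone.precompose (Functor.whiskerLeft K h.r)).obj s) :=
                hG.uniq ((Cocone.precompose (Functor.whiskerLeft K h.r)).obj s) _ fun j => by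
                  have := hm j
                  dsimp at this ⊢
                  rw [h.r.naturality_assoc, this]
              rw [← this, reassoc_of% (hir c.pt)] }⟩ }

variable {C : Type u} [Category.{v} C] [Preadditive C]

theorem IsCompactObj.of_retract {x y : C} (h : Retract x y) (hy : IsCompactObj y) :
    IsCompactObj x := fun J =>
  ⟨haveI := (hy J).some
   preservesColimitsOfShape_of_retract (h.op.map preadditiveCoyoneda)⟩

theorem IsCompactObj.of_iso {x y : C} (e : x ≅ y) (hy : IsCompactObj y) : IsCompactObj x :=
  hy.of_retract ⟨e.hom, e.inv, e.hom_inv_id⟩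

/-- A left adjoint whose right adjoint is additive and preserves coproducts
preserves compact objects. -/
theorem IsCompactObj.map_of_adjunction {D : Type u₂} [Category.{v} D] [Preadditive D]
    {F : C ⥤ D} {G : D ⥤ C} (adj : F ⊣ G) [F.Additive] (hG : PreservesCoproducts G) {x : C}
    (hx : IsCompactObj x) : IsCompactObj (F.obj x) := fun J => by
  have := (hx J).some
  have := (hG J).some
  let e : G ⋙ preadditiveCoyoneda.obj (op x) ≅ preadditiveCoyoneda.obj (op (F.obj x)) :=
    NatIso.ofComponents (fun Y => (adj.homAddEquiv x Y).symm.toAddCommGrpIso) fun {Y Z} f => by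
      ext g
      exact adj.homEquiv_naturality_right_symm g f
  exact ⟨preservesColimitsOfShape_of_natIso e⟩

theorem IsCompactObj.shift [HasShift C ℤ] [∀ n : ℤ, (shiftFunctor C n).Additive] {x : C}
    (hx : IsCompactObj x) (n : ℤ) : IsCompactObj (x⟦n⟧) :=
  haveI : (shiftEquiv C n).functor.Additive := inferInstanceAs (shiftFunctor C n).Additive
  hx.map_of_adjunction (shiftEquiv C n).toAdjunction fun _ =>
    ⟨inferInstanceAs (PreservesColimitsOfShape _ (shiftEquiv C n).inverse)⟩

/-- In a category with a set of compact generators, a morphism inducing bijections on maps out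
of compact objects is an isomorphism. -/
theorem isIso_of_bijective_comp [HasZeroObject C] [HasShift C ℤ]
    [∀ n : ℤ, (shiftFunctor C n).Additive] [Pretriangulated C]
    (hgen : ∃ (ι : Type v) (G : ι → C), (∀ i, IsCompactObj (G i)) ∧
      ∀ t : C, (∀ (i : ι) (f : G i ⟶ t), f = 0) → IsZero t)
    {x y : C} (g : x ⟶ y)
    (hg : ∀ d : C, IsCompactObj d → Function.Bijective fun h : d ⟶ x => h ≫ g) : IsIso g := by
  obtain ⟨ι, G, hG, hzero⟩ := hgen
  obtain ⟨z, p, q, hT⟩ := distinguished_cocone_triangle g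
  refine ((Triangle.mk g p q).isZero₃_iff_isIso₁ hT).1 (hzero z fun i f => ?_)
  have hq : f ≫ q = 0 := by
    obtain ⟨k, hk⟩ : ∃ k : (G i)⟦(-1 : ℤ)⟧ ⟶ x,
        (shiftFunctorCompIsoId C (-1 : ℤ) 1 (by simp)).hom.app (G i) ≫ f ≫ q = k⟦(1 : ℤ)⟧' :=
      (shiftFunctor C (1 : ℤ)).map_surjective _ |>.imp fun _ h => h.symm
    have hkg : k ≫ g = 0 := by
      apply (shiftFunctor C (1 : ℤ)).map_injective
      have h0 : q ≫ g⟦(1 : ℤ)⟧' = 0 := comp_distTriang_mor_zero₃₁ _ hT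
      rw [Functor.map_comp, ← hk, Category.assoc, Category.assoc, h0]
      simp
    have hk0 : k = 0 := (hg _ ((hG i).shift _)).1 (by simpa using hkg)
    rw [hk0, Functor.map_zero] at hk
    rwa [← cancel_epi ((shiftFunctorCompIsoId C (-1 : ℤ) 1 (by simp)).hom.app (G i)), comp_zero]
  obtain ⟨h, hf⟩ : ∃ h : G i ⟶ y, f = h ≫ p := Triangle.coyoneda_exact₃ _ hT f hq
  obtain ⟨k, hk⟩ : ∃ k : G i ⟶ x, k ≫ g = h := (hg _ (hG i)).2 h
  have h0 : g ≫ p = 0 := comp_distTriang_mor_zero₁₂ _ hT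
  rw [hf, ← hk, Category.assoc, h0, comp_zero]

end CompactLemmas

section RigidLemmas

open Functor.LaxMonoidal Functor.OplaxMonoidal

variable {C : Type u} [Category.{v} C] [MonoidalCategory C]

/-- The image of an exact pairing under a monoidal functor. -/
@[reducible] def exactPairingMap {D : Type u₂} [Category.{v} D] [MonoidalCategory D]
    (F : C ⥤ D) [F.Monoidal] (X Y : C) [ExactPairing X Y] :
    ExactPairing (F.obj X) (F.obj Y) where
  coevaluation' := ε F ≫ F.map (η_ X Y) ≫ δ F X Y
  evaluation' := μ F Y X ≫ F.map (ε_ X Y) ≫ η F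
  coevaluation_evaluation' := by
    have h := F.congr_map (ExactPairing.coevaluation_evaluation X Y)
    simp only [Functor.map_comp, Functor.Monoidal.map_whiskerLeft,
      Functor.Monoidal.map_whiskerRight, Functor.Monoidal.map_associator_inv,
      Functor.Monoidal.map_rightUnitor, Functor.Monoidal.map_leftUnitor_inv, Category.assoc,
      Functor.Monoidal.μ_δ_assoc, cancel_epi] at h
    simp only [← Category.assoc, cancel_mono] at h
    simp only [Category.assoc] at h
    simp only [whiskerLeft_comp, comp_whiskerRight, Category.assoc, reassoc_of% h]
    simp [-Functor.LaxMonoidal.right_unitality]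
  evaluation_coevaluation' := by
    have h := F.congr_map (ExactPairing.evaluation_coevaluation X Y)
    simp only [Functor.map_comp, Functor.Monoidal.map_whiskerLeft,
      Functor.Monoidal.map_whiskerRight, Functor.Monoidal.map_associator,
      Functor.Monoidal.map_leftUnitor, Functor.Monoidal.map_rightUnitor_inv, Category.assoc,
      Functor.Monoidal.μ_δ_assoc, cancel_epi] at h
    simp only [← Category.assoc, cancel_mono] at h
    simp only [Category.assoc] at h
    simp only [whiskerLeft_comp, comp_whiskerRight, Category.assoc, reassoc_of% h]
    simp [-Functor.LaxMonoidal.right_unitality]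

/-- One triangle identity of a pairing implies the other one after applying `x ⊗ -` and
evaluating. -/
theorem whiskerLeft_snake {x y : C} (c : 𝟙_ C ⟶ y ⊗ x) (e : x ⊗ y ⟶ 𝟙_ C)
    (h : x ◁ c ≫ (α_ x y x).inv ≫ e ▷ x = (ρ_ x).hom ≫ (λ_ x).inv) :
    x ◁ (c ▷ y ≫ (α_ y x y).hom ≫ y ◁ e) ≫ (α_ x y (𝟙_ C)).inv ≫ e ▷ (𝟙_ C) ≫ (λ_ (𝟙_ C)).hom =
      x ◁ ((λ_ y).hom ≫ (ρ_ y).inv) ≫ (α_ x y (𝟙_ C)).inv ≫ e ▷ (𝟙_ C) ≫ (λ_ (𝟙_ C)).hom := by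
  calc
    _ = 𝟙 _ ⊗≫ x ◁ c ▷ y ⊗≫ ((x ⊗ y) ◁ e ≫ e ▷ (𝟙_ C)) ⊗≫ 𝟙 _ := by monoidal
    _ = 𝟙 _ ⊗≫ (x ◁ c ≫ (α_ x y x).inv ≫ e ▷ x) ▷ y ⊗≫ e := by
      rw [whisker_exchange]; monoidal
    _ = _ := by rw [h]; monoidal

variable [MonoidalClosed C]

theorem whiskerLeft_rigidComparison_ev (x y : C) :
    x ◁ rigidComparison x y ≫ (ihom.ev x).app y =
      (α_ x ((ihom x).obj (𝟙_ C)) y).inv ≫ (ihom.ev x).app (𝟙_ C) ▷ y ≫ (λ_ y).hom :=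
  whiskerLeft_curry_ihom_ev_app _ _ _

/-- A rigid object `x` is dual to `hom(x,𝟙)`. -/
theorem IsRigid.nonempty_exactPairing {x : C} (hx : IsRigid x) :
    Nonempty (ExactPairing ((ihom x).obj (𝟙_ C)) x) := by
  have := hx x
  have := hx (𝟙_ C)
  have h₁ : x ◁ (curry (ρ_ x).hom ≫ inv (rigidComparison x x)) ≫
      (α_ x ((ihom x).obj (𝟙_ C)) x).inv ≫ (ihom.ev x).app (𝟙_ C) ▷ x =
        (ρ_ x).hom ≫ (λ_ x).inv := by
    rw [← cancel_mono (λ_ x).hom, Category.assoc, Category.assoc, ← whiskerLeft_rigidComparison_ev,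
      ← whiskerLeft_comp_assoc, Category.assoc, IsIso.inv_hom_id, Category.comp_id,
      whiskerLeft_curry_ihom_ev_app, Category.assoc, Iso.inv_hom_id, Category.comp_id]
  refine ⟨{
    coevaluation' := curry (ρ_ x).hom ≫ inv (rigidComparison x x)
    evaluation' := (ihom.ev x).app (𝟙_ C)
    coevaluation_evaluation' := h₁
    evaluation_coevaluation' := ?_ }⟩
  rw [← cancel_mono (rigidComparison x (𝟙_ C))]
  apply uncurry_injective
  rw [uncurry_natural_left, uncurry_natural_left]
  dsimp only [rigidComparison]
  rw [uncurry_curry]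
  exact whiskerLeft_snake _ _ h₁

theorem isRigid_of_exactPairing (x' x : C) [ExactPairing x' x] : IsRigid x := by
  let e (y : C) : x' ⊗ y ⟶ (ihom x).obj y :=
    curry ((α_ x x' y).inv ≫ ε_ x' x ▷ y ≫ (λ_ y).hom)
  have he (y : C) : IsIso (e y) := by
    rw [isIso_iff_yoneda_map_bijective]
    intro d
    convert! ((tensorLeftHomEquiv d x' x y).symm.trans
      ((ihom.adjunction x).homEquiv d y)).bijective using 1
    ext h
    exact (curry_natural_left h _).symm
  intro y
  have h : e y = ((ρ_ x').inv ≫ e (𝟙_ C)) ▷ y ≫ rigidComparison x y := by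
    apply uncurry_injective
    rw [uncurry_natural_left]
    dsimp only [rigidComparison, e]
    rw [uncurry_curry, uncurry_curry, associator_inv_naturality_middle_assoc,
      ← comp_whiskerRight_assoc, whiskerLeft_comp, Category.assoc, whiskerLeft_curry_ihom_ev_app]
    monoidal
  have : IsIso (((ρ_ x').inv ≫ e (𝟙_ C)) ▷ y ≫ rigidComparison x y) := h ▸ he y
  exact IsIso.of_isIso_comp_left (((ρ_ x').inv ≫ e (𝟙_ C)) ▷ y) _

end RigidLemmas

section Counit

variable {D : Type u₁} {C : Type u₂} [Category.{v} D] [Category.{v} C]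
  {F : D ⥤ C} {G : C ⥤ D} (adj : F ⊣ G)

/-- The counit `F (G y) ⟶ y` of an adjunction, with its source and target in applied form. -/
def counitHom (y : C) : F.obj (G.obj y) ⟶ y :=
  adj.counit.app y

theorem map_map_counitHom {y z : C} (b : y ⟶ z) :
    F.map (G.map b) ≫ counitHom adj z = counitHom adj y ≫ b :=
  adj.counit_naturality b

theorem homEquiv_symm_eq_counitHom {x : D} {y : C}
    (h : x ⟶ G.obj y) : (adj.homEquiv x y).symm h = F.map h ≫ counitHom adj y :=
  adj.homEquiv_counit x y h

theorem homEquiv_counitHom_comp {y z : C} (b : y ⟶ z) :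
    adj.homEquiv _ _ (counitHom adj y ≫ b) = G.map b := by
  rw [← map_map_counitHom, ← homEquiv_symm_eq_counitHom, Equiv.apply_symm_apply]

end Counit

section Projection

open Functor.LaxMonoidal Functor.OplaxMonoidal

variable {D : Type u₁} {C : Type u₂} [Category.{v} D] [Category.{v} C]
  [MonoidalCategory D] [MonoidalCategory C]
  {fstar : D ⥤ C} [fstar.Monoidal] {fpush : C ⥤ D} (adj : fstar ⊣ fpush)

/-- The projection formula map `f_*(y) ⊗ d ⟶ f_*(y ⊗ f^*(d))`. -/
def projFormulaRight (y : C) (d : D) : fpush.obj y ⊗ d ⟶ fpush.obj (y ⊗ fstar.obj d) :=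
  adj.homEquiv _ _ (δ fstar (fpush.obj y) d ≫ counitHom adj y ▷ fstar.obj d)

theorem projFormulaRight_naturality_right (y : C) {d e : D} (h : d ⟶ e) :
    fpush.obj y ◁ h ≫ projFormulaRight adj y e =
      projFormulaRight adj y d ≫ fpush.map (y ◁ fstar.map h) := by
  rw [projFormulaRight, projFormulaRight, ← adj.homEquiv_naturality_left,
    ← adj.homEquiv_naturality_right, Category.assoc, ← whisker_exchange, δ_natural_right_assoc]

theorem projFormulaRight_naturality_left {y z : C} (b : y ⟶ z) (d : D) :
    fpush.map b ▷ d ≫ projFormulaRight adj z d =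
      projFormulaRight adj y d ≫ fpush.map (b ▷ fstar.obj d) := by
  rw [projFormulaRight, projFormulaRight, ← adj.homEquiv_naturality_left,
    ← adj.homEquiv_naturality_right, Category.assoc, ← comp_whiskerRight, ← map_map_counitHom,
    comp_whiskerRight, δ_natural_left_assoc]

theorem unit_whiskerRight_projFormulaRight (d : D) :
    (λ_ d).inv ≫ adj.homEquiv _ _ (η fstar) ▷ d ≫ projFormulaRight adj (𝟙_ C) d =
      adj.homEquiv _ _ (λ_ (fstar.obj d)).inv := by
  rw [projFormulaRight, ← adj.homEquiv_naturality_left, ← adj.homEquiv_naturality_left]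
  congr 1
  rw [← δ_natural_left_assoc, ← comp_whiskerRight, ← homEquiv_symm_eq_counitHom,
    Equiv.symm_apply_apply, Functor.OplaxMonoidal.left_unitality]

theorem isIso_projFormulaRight (y : C) (d' d : D) [ExactPairing d' d] :
    IsIso (projFormulaRight adj y d) := by
  rw [isIso_iff_yoneda_map_bijective]
  intro e
  let _ := exactPairingMap fstar d' d
  convert! ((tensorRightHomEquiv e d' d (fpush.obj y)).symm.trans
    ((adj.homEquiv _ _).symm.trans (((Functor.Monoidal.μIso fstar e d').symm.homFromEquiv).trans
      ((tensorRightHomEquiv (fstar.obj e) (fstar.obj d') (fstar.obj d) y).trans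
        (adj.homEquiv _ _))))).bijective using 1
  ext k
  simp only [Equiv.trans_apply]
  rw [projFormulaRight, ← adj.homEquiv_naturality_left]
  congr 1
  rw [← Equiv.symm_apply_eq]
  have hev : ε_ (fstar.obj d') (fstar.obj d) = μ fstar d d' ≫ fstar.map (ε_ d' d) ≫ η fstar := rfl
  simp only [tensorRightHomEquiv, homEquiv_symm_eq_counitHom, Equiv.coe_fn_symm_mk,
    Iso.homFromEquiv_apply, Iso.symm_inv, Functor.Monoidal.μIso_hom, hev, Functor.map_comp,
    Category.assoc, comp_whiskerRight]
  simp only [Functor.Monoidal.map_associator, Functor.Monoidal.map_rightUnitor,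
    Functor.Monoidal.map_whiskerLeft, Functor.Monoidal.map_whiskerRight, Category.assoc,
    Functor.Monoidal.μ_δ_assoc, associator_naturality_left_assoc, whiskerLeft_comp,
    ← rightUnitor_naturality, whisker_exchange_assoc]

variable {fone : D ⥤ C} (adj2 : fpush ⊣ fone)

/-- The pairing `f_*(y) ⊗ f_*(y' ⊗ ω) ⟶ 𝟙` induced by a pairing of `y` and `y'`,
where `ω = f^(1)(𝟙)`. -/
def pushPairing (y' y : C) [ExactPairing y' y] :
    fpush.obj y ⊗ fpush.obj (y' ⊗ fone.obj (𝟙_ D)) ⟶ 𝟙_ D :=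
  projFormulaRight adj y (fpush.obj (y' ⊗ fone.obj (𝟙_ D))) ≫
    fpush.map (y ◁ counitHom adj (y' ⊗ fone.obj (𝟙_ D)) ≫
      (tensorLeftHomEquiv _ y' y _).symm (𝟙 (y' ⊗ fone.obj (𝟙_ D)))) ≫ counitHom adj2 (𝟙_ D)

theorem whiskerLeft_pushPairing_bijective (y' y : C) [ExactPairing y' y] (d' d : D)
    [ExactPairing d' d] :
    Function.Bijective fun h : d ⟶ fpush.obj (y' ⊗ fone.obj (𝟙_ D)) =>
      fpush.obj y ◁ h ≫ pushPairing adj adj2 y' y := by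
  have := isIso_projFormulaRight adj y d' d
  convert! ((adj.homEquiv _ _).symm.trans ((tensorLeftHomEquiv _ y' y _).symm.trans
    ((adj2.homEquiv _ _).symm.trans
      ((asIso (projFormulaRight adj y d)).symm.homFromEquiv)))).bijective using 1
  ext h
  simp only [Equiv.trans_apply, pushPairing]
  rw [← Category.assoc, projFormulaRight_naturality_right, Category.assoc, ← fpush.map_comp_assoc,
    ← tensorLeftHomEquiv_symm_naturality, ← tensorLeftHomEquiv_symm_naturality, Category.comp_id,
    ← homEquiv_symm_eq_counitHom,
    ← homEquiv_symm_eq_counitHom]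
  rfl

/-- The canonical map `f_*(y' ⊗ ω) ⟶ r' ⊗ 𝟙`, where `y'` is dual to `y` and `r'` to `f_*(y)`. -/
def pushToDual (y' y : C) [ExactPairing y' y] (r' : D) [ExactPairing r' (fpush.obj y)] :
    fpush.obj (y' ⊗ fone.obj (𝟙_ D)) ⟶ r' ⊗ 𝟙_ D :=
  tensorLeftHomEquiv _ r' (fpush.obj y) _ (pushPairing adj adj2 y' y)

theorem comp_pushToDual_bijective (y' y : C) [ExactPairing y' y] (r' : D)
    [ExactPairing r' (fpush.obj y)] (d' d : D) [ExactPairing d' d] :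
    Function.Bijective fun h : d ⟶ fpush.obj (y' ⊗ fone.obj (𝟙_ D)) =>
      h ≫ pushToDual adj adj2 y' y r' := by
  rw [← Function.Bijective.of_comp_iff' (tensorLeftHomEquiv d r' (fpush.obj y) _).symm.bijective]
  convert! whiskerLeft_pushPairing_bijective adj adj2 y' y d' d using 1
  ext h
  simp [pushToDual, tensorLeftHomEquiv_symm_naturality]

/-- Transposition `Hom(𝟙,r) ≃ Hom(r',𝟙)` for an exact pairing. -/
theorem transpose_bijective (r' r : C) [ExactPairing r' r] :
    Function.Bijective fun b : 𝟙_ C ⟶ r => (λ_ r').inv ≫ b ▷ r' ≫ ε_ r' r := by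
  convert! (((λ_ r).symm.homToEquiv).trans ((tensorRightHomEquiv (𝟙_ C) r' r (𝟙_ C)).symm.trans
    ((λ_ r').homFromEquiv))).bijective using 1
  ext b
  simp only [tensorRightHomEquiv, Equiv.trans_apply, Equiv.coe_fn_symm_mk, Iso.homToEquiv_apply,
    Iso.homFromEquiv_apply, Iso.symm_hom]
  monoidal

theorem tensorLeftHomEquiv_comp_transpose (r' r x : C) [ExactPairing r' r] (b : 𝟙_ C ⟶ r)
    (p : r ⊗ x ⟶ 𝟙_ C) :
    tensorLeftHomEquiv _ r' r _ p ≫ (ρ_ r').hom ≫ (λ_ r').inv ≫ b ▷ r' ≫ ε_ r' r =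
      (λ_ x).inv ≫ b ▷ x ≫ p := by
  obtain ⟨g, rfl⟩ := (tensorLeftHomEquiv _ r' r _).symm.surjective p
  rw [Equiv.apply_symm_apply]
  simp only [tensorLeftHomEquiv, Equiv.coe_fn_symm_mk]
  rw [← whisker_exchange_assoc]
  monoidal

theorem whiskerRight_comp_tensorLeftHomEquiv_symm_id (y' y w : C) [ExactPairing y' y]
    (b : 𝟙_ C ⟶ y) :
    (λ_ (y' ⊗ w)).inv ≫ b ▷ (y' ⊗ w) ≫ (tensorLeftHomEquiv _ y' y _).symm (𝟙 (y' ⊗ w)) =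
      ((λ_ y').inv ≫ b ▷ y' ≫ ε_ y' y) ▷ w ≫ (λ_ w).hom := by
  simp only [tensorLeftHomEquiv, Equiv.coe_fn_symm_mk]
  monoidal

theorem whiskerRight_comp_pushPairing (y' y : C) [ExactPairing y' y] (b : 𝟙_ C ⟶ y) :
    (λ_ _).inv ≫ adj.homEquiv _ _ (η fstar ≫ b) ▷ _ ≫ pushPairing adj adj2 y' y =
      fpush.map (((λ_ y').inv ≫ b ▷ y' ≫ ε_ y' y) ▷ _ ≫ (λ_ _).hom) ≫ counitHom adj2 _ := by
  rw [← whiskerRight_comp_tensorLeftHomEquiv_symm_id, adj.homEquiv_naturality_right, pushPairing,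
    comp_whiskerRight_assoc, ← Category.assoc (fpush.map b ▷ _),
    projFormulaRight_naturality_left, Category.assoc, ← fpush.map_comp_assoc,
    reassoc_of% unit_whiskerRight_projFormulaRight adj, ← Category.assoc,
    ← adj.homEquiv_naturality_right, ← homEquiv_counitHom_comp adj, ← whisker_exchange_assoc,
    leftUnitor_inv_naturality_assoc]

theorem whiskerRight_bijective (y' y : C) [ExactPairing y' y] (r' : D)
    [ExactPairing r' (fpush.obj y)] [IsIso (pushToDual adj adj2 y' y r')] :
    Function.Bijective fun a : y' ⟶ 𝟙_ C => a ▷ fone.obj (𝟙_ D) ≫ (λ_ (fone.obj (𝟙_ D))).hom := by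
  rw [← Function.Bijective.of_comp_iff _ (transpose_bijective y' y),
    ← Function.Bijective.of_comp_iff' (adj2.homEquiv _ _).symm.bijective]
  convert! ((asIso (η fstar)).symm.homFromEquiv.trans ((adj.homEquiv _ _).trans
    ((Equiv.ofBijective _ (transpose_bijective r' (fpush.obj y))).trans
      ((ρ_ r').symm.homFromEquiv.trans
        (asIso (pushToDual adj adj2 y' y r')).symm.homFromEquiv)))).bijective using 1
  ext b
  simp only [Function.comp_apply, homEquiv_symm_eq_counitHom]
  rw [← whiskerRight_comp_pushPairing adj adj2 y' y b, ← tensorLeftHomEquiv_comp_transpose r']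
  simp [pushToDual]

/-- If `Hom(c,𝟙) ⟶ Hom(c ⊗ ω,ω)` is bijective, so is composition with the coevaluation of `ω`. -/
theorem comp_coevaluation_bijective (w w' c : C) [ExactPairing w w']
    (h : Function.Bijective fun a : c ⟶ 𝟙_ C => a ▷ w ≫ (λ_ w).hom) :
    Function.Bijective fun a : c ⟶ 𝟙_ C => a ≫ η_ w w' := by
  rw [← Function.Bijective.of_comp_iff' (tensorRightHomEquiv c w w' w).symm.bijective]
  convert! h using 1
  ext a
  simp [tensorRightHomEquiv]

end Projection

section Wirthmuller

theorem RigidlyCompactlyGenerated.nonempty_exactPairing {C : Type u} [Category.{v} C]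
    [Preadditive C] [MonoidalCategory C] [MonoidalClosed C] (hC : RigidlyCompactlyGenerated C)
    {x : C} (hx : IsCompactObj x) : Nonempty (ExactPairing ((ihom x).obj (𝟙_ C)) x) :=
  ((hC.compact_iff_rigid x).1 hx).nonempty_exactPairing

theorem RigidlyCompactlyGenerated.isCompactObj_of_exactPairing {C : Type u} [Category.{v} C]
    [Preadditive C] [MonoidalCategory C] [MonoidalClosed C] (hC : RigidlyCompactlyGenerated C)
    (x' x : C) [ExactPairing x' x] : IsCompactObj x :=
  (hC.compact_iff_rigid x).2 (isRigid_of_exactPairing x' x)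

theorem isIso_pushToDual {D : Type u₁} {C : Type u₂} [Category.{v} D] [Preadditive D]
    [HasZeroObject D] [HasShift D ℤ] [∀ n : ℤ, (shiftFunctor D n).Additive] [Pretriangulated D]
    [MonoidalCategory D] [MonoidalClosed D] [Category.{v} C] [MonoidalCategory C]
    {fstar : D ⥤ C} [fstar.Monoidal] {fpush : C ⥤ D} {fone : D ⥤ C}
    (hD : RigidlyCompactlyGenerated D) (adj1 : fstar ⊣ fpush) (adj2 : fpush ⊣ fone)
    (y' y : C) [ExactPairing y' y] (r' : D)
    [ExactPairing r' (fpush.obj y)] : IsIso (pushToDual adj1 adj2 y' y r') :=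
  isIso_of_bijective_comp hD.exists_generators _ fun d hd => by
    obtain ⟨_⟩ := hD.nonempty_exactPairing hd
    exact comp_pushToDual_bijective adj1 adj2 y' y r' ((ihom d).obj (𝟙_ D)) d

/-- A faithful push-forward `f_*` detects compact objects. -/
theorem isCompactObj_of_faithful {D : Type u₁} {C : Type u₂} [Category.{v} D] [Preadditive D]
    [MonoidalCategory D] [MonoidalClosed D] [Category.{v} C] [Preadditive C] [HasZeroObject C]
    [HasShift C ℤ] [∀ n : ℤ, (shiftFunctor C n).Additive] [Pretriangulated C]
    [MonoidalCategory C] [MonoidalClosed C] {fstar : D ⥤ C} [fstar.Monoidal] {fpush : C ⥤ D}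
    (hD : RigidlyCompactlyGenerated D) (hC : RigidlyCompactlyGenerated C)
    (adj : fstar ⊣ fpush) [fpush.Faithful] {x : C}
    (hx : IsCompactObj (fpush.obj x)) : IsCompactObj x := by
  obtain ⟨_⟩ := hD.nonempty_exactPairing hx
  let r' := (ihom (fpush.obj x)).obj (𝟙_ D)
  let _ := exactPairingMap fstar r' (fpush.obj x)
  have := isSplitEpi_of_epi (adj.counit.app x)
  exact (hC.isCompactObj_of_exactPairing (fstar.obj r') (fstar.obj (fpush.obj x))).of_retract
    ⟨section_ (adj.counit.app x), adj.counit.app x, IsSplitEpi.id _⟩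

variable {D : Type u₁} {C : Type u₂} [Category.{v} D] [Preadditive D] [HasZeroObject D]
  [HasShift D ℤ] [∀ n : ℤ, (shiftFunctor D n).Additive] [Pretriangulated D]
  [MonoidalCategory D] [MonoidalClosed D] [Category.{v} C] [Preadditive C]
  [MonoidalCategory C] [MonoidalClosed C] {fstar : D ⥤ C} [fstar.Monoidal] {fpush : C ⥤ D}
  {fone : D ⥤ C}

/-- If `f_*` preserves compact objects, then `f_*(y ⊗ ω)` is compact for compact `y`. -/
theorem isCompactObj_map_tensor_dualizing [BraidedCategory D] [BraidedCategory C]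
    (hD : RigidlyCompactlyGenerated D) (hC : RigidlyCompactlyGenerated C)
    (adj1 : fstar ⊣ fpush) (adj2 : fpush ⊣ fone)
    (hGN : ∀ x : C, IsCompactObj x → IsCompactObj (fpush.obj x)) {y : C} (hy : IsCompactObj y) :
    IsCompactObj (fpush.obj (y ⊗ fone.obj (𝟙_ D))) := by
  obtain ⟨_⟩ := hC.nonempty_exactPairing hy
  let z := (ihom y).obj (𝟙_ C)
  let _ : ExactPairing y z := BraidedCategory.exactPairing_swap z y
  have hz : IsCompactObj z := hC.isCompactObj_of_exactPairing y z
  obtain ⟨_⟩ := hD.nonempty_exactPairing (hGN z hz)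
  let r' := (ihom (fpush.obj z)).obj (𝟙_ D)
  have := isIso_pushToDual hD adj1 adj2 y z r'
  let _ : ExactPairing (fpush.obj z) r' := BraidedCategory.exactPairing_swap r' (fpush.obj z)
  have h : IsCompactObj r' := hD.isCompactObj_of_exactPairing (fpush.obj z) r'
  exact h.of_iso (asIso (pushToDual adj1 adj2 y z r') ≪≫ rightUnitor _)

variable [HasZeroObject C] [HasShift C ℤ] [∀ n : ℤ, (shiftFunctor C n).Additive]
  [Pretriangulated C]

/-- If `f_*` preserves compact objects and `ω` is compact, then `ω` is invertible. -/
theorem tensorInvertible_of_isCompactObj [BraidedCategory C]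
    (hD : RigidlyCompactlyGenerated D) (hC : RigidlyCompactlyGenerated C)
    (adj1 : fstar ⊣ fpush) (adj2 : fpush ⊣ fone)
    (hGN : ∀ x : C, IsCompactObj x → IsCompactObj (fpush.obj x))
    (hω : IsCompactObj (fone.obj (𝟙_ D))) : TensorInvertible (fone.obj (𝟙_ D)) := by
  obtain ⟨_⟩ := hC.nonempty_exactPairing hω
  let ω := fone.obj (𝟙_ D)
  let ω' := (ihom ω).obj (𝟙_ C)
  let _ : ExactPairing ω ω' := BraidedCategory.exactPairing_swap ω' ω
  have : IsIso (η_ ω ω') := by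
    refine isIso_of_bijective_comp hC.exists_generators _ fun c hc =>
      comp_coevaluation_bijective ω ω' c ?_
    obtain ⟨_⟩ := hC.nonempty_exactPairing hc
    let c' := (ihom c).obj (𝟙_ C)
    let _ : ExactPairing c c' := BraidedCategory.exactPairing_swap c' c
    obtain ⟨_⟩ := hD.nonempty_exactPairing (hGN c' (hC.isCompactObj_of_exactPairing c c'))
    let r' := (ihom (fpush.obj c')).obj (𝟙_ D)
    have := isIso_pushToDual hD adj1 adj2 c c' r'
    exact whiskerRight_bijective adj1 adj2 c c' r'
  exact ⟨ω', ⟨(asIso (η_ ω ω')).symm⟩⟩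

end Wirthmuller

/-- Sufficient conditions for the Wirthmüller isomorphism,
Theorem 1.7, "finally" part. -/
theorem statement10 {D : Type u₁} {C : Type u₂}
    [Category.{v} D] [Preadditive D] [HasZeroObject D] [HasShift D ℤ]
    [∀ n : ℤ, (shiftFunctor D n).Additive] [Pretriangulated D] [IsTriangulated D]
    [MonoidalCategory D] [SymmetricCategory D] [MonoidalClosed D]
    [Category.{v} C] [Preadditive C] [HasZeroObject C] [HasShift C ℤ]
    [∀ n : ℤ, (shiftFunctor C n).Additive] [Pretriangulated C] [IsTriangulated C]
    [MonoidalCategory C] [SymmetricCategory C] [MonoidalClosed C]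
    (fstar : D ⥤ C) [fstar.Braided] [fstar.CommShift ℤ] [fstar.IsTriangulated]
    (hD : RigidlyCompactlyGenerated D) (hC : RigidlyCompactlyGenerated C)
    (hcop : PreservesCoproducts fstar)
    (fpush : C ⥤ D) (adj1 : fstar ⊣ fpush)
    (fone : D ⥤ C) (adj2 : fpush ⊣ fone)
    (hGN : ∀ x : C, IsCompactObj x → IsCompactObj (fpush.obj x)) :
    (fpush.Faithful → TensorInvertible (fone.obj (𝟙_ D))) ∧
    ((∀ x : C, IsCompactObj (fpush.obj x) → IsCompactObj x) →
      TensorInvertible (fone.obj (𝟙_ D))) ∧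
    ((∀ x : C, (∀ y : C, IsCompactObj y → IsCompactObj (fpush.obj (x ⊗ y))) →
        IsCompactObj x) →
      TensorInvertible (fone.obj (𝟙_ D))) ∧
    (fpush.Faithful → ∀ x : C, IsCompactObj (fpush.obj x) → IsCompactObj x) ∧
    ((∀ x : C, IsCompactObj (fpush.obj x) → IsCompactObj x) →
      ∀ x : C, (∀ y : C, IsCompactObj y → IsCompactObj (fpush.obj (x ⊗ y))) →
        IsCompactObj x) := by
  have h₁₂ : fpush.Faithful → ∀ x : C, IsCompactObj (fpush.obj x) → IsCompactObj x :=
    fun _ _ hx => isCompactObj_of_faithful hD hC adj1 hx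
  have h₂₃ (h : ∀ x : C, IsCompactObj (fpush.obj x) → IsCompactObj x) (x : C)
      (hx : ∀ y : C, IsCompactObj y → IsCompactObj (fpush.obj (x ⊗ y))) : IsCompactObj x :=
    h x ((hx _ (hC.isCompactObj_of_exactPairing (𝟙_ C) (𝟙_ C))).of_iso
      (fpush.mapIso (ρ_ x).symm))
  have h₃ (h : ∀ x : C, (∀ y : C, IsCompactObj y → IsCompactObj (fpush.obj (x ⊗ y))) →
      IsCompactObj x) : TensorInvertible (fone.obj (𝟙_ D)) :=
    tensorInvertible_of_isCompactObj hD hC adj1 adj2 hGN <| h _ fun y hy =>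
      (isCompactObj_map_tensor_dualizing hD hC adj1 adj2 hGN hy).of_iso (fpush.mapIso (β_ _ _))
  exact ⟨fun h => h₃ (h₂₃ (h₁₂ h)), fun h => h₃ (h₂₃ h), h₃, h₁₂, h₂₃⟩

end GN
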